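/- Let 0 < s₀ < K and T₀ > 0. For σ > 0 and T > 0 let C_E(σ,T) = σ√T · φ((s₀−K)/(σ√T)) + (s₀−K) · Φ((s₀−K)/(σ√T)) denote the Bachelier (normal model) European call price with volatility σ, strike K, spot s₀ and time to expiry T. Suppose C : (0,T₀) → (0,∞) and σ_N : (0,T₀) → (0,∞) satisfy C(T) = C_E(σ_N(T), T) for all T ∈ (0,T₀), and that C(T) → 0 as T → 0⁺. Then σ_N(T)² T · (log s₀ − log C(T)) → (s₀−K)²/2 as T → 0⁺; that is, the implied normal volatility satisfies σ_N(T)²T = (s₀−K)²/(2(log s₀ − log C(T))) (1 + o(1)). -/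

import Mathlib

open Real Filter

/-- The standard normal density. -/
noncomputable def stdNormalPDF (x : ℝ) : ℝ :=
  (Real.sqrt (2 * Real.pi))⁻¹ * Real.exp (-x ^ 2 / 2)

/-- The standard normal cumulative distribution function. -/
noncomputable def stdNormalCDF (x : ℝ) : ℝ :=
  (Real.sqrt (2 * Real.pi))⁻¹ * ∫ u in Set.Iic x, Real.exp (-u ^ 2 / 2)

/-- The Bachelier (normal model) European call price with volatility `σ`, strike `K`,
spot `s₀` and time to expiry `T`. -/
noncomputable def bachelierEuropeanCall (s₀ K σ T : ℝ) : ℝ :=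
  σ * Real.sqrt T * stdNormalPDF ((s₀ - K) / (σ * Real.sqrt T))
    + (s₀ - K) * stdNormalCDF ((s₀ - K) / (σ * Real.sqrt T))

open MeasureTheory in
/-- The Gaussian first-order integral `∫_{-∞}^y (y - u) e^{-u²/2} du`, with its integrability. -/
theorem integral_Iic_sub_mul_exp_neg_sq_div_two (y : ℝ) :
    IntegrableOn (fun u : ℝ => (y - u) * Real.exp (-u ^ 2 / 2)) (Set.Iic y) ∧
      ∫ u in Set.Iic y, (y - u) * Real.exp (-u ^ 2 / 2) =
        Real.exp (-y ^ 2 / 2) + y * ∫ u in Set.Iic y, Real.exp (-u ^ 2 / 2) := by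
  have h_exp : Integrable (fun u : ℝ => Real.exp (-u ^ 2 / 2)) := by
    convert integrable_exp_neg_mul_sq (b := 1 / 2) (by norm_num) using 3
    ring
  have h_mul : Integrable (fun u : ℝ => -u * Real.exp (-u ^ 2 / 2)) := by
    convert (integrable_mul_exp_neg_mul_sq (b := 1 / 2) (by norm_num)).neg using 2 with u
    rw [Pi.neg_apply, neg_mul]
    ring_nf
  have h_deriv : ∀ u ∈ Set.Iic y,
      HasDerivAt (fun u : ℝ => Real.exp (-u ^ 2 / 2)) (-u * Real.exp (-u ^ 2 / 2)) u := by
    intro u _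
    convert ((hasDerivAt_pow 2 u).fun_neg.div_const 2).exp using 1
    ring
  have h_lim : Tendsto (fun u : ℝ => Real.exp (-u ^ 2 / 2)) atBot (nhds 0) := by
    refine Real.tendsto_exp_atBot.comp ?_
    have h_sq : Tendsto (fun u : ℝ => u ^ 2) atBot atTop := by
      simpa [Function.comp_def] using
        (tendsto_pow_atTop (α := ℝ) two_ne_zero).comp tendsto_abs_atBot_atTop
    exact (tendsto_neg_atTop_atBot.comp h_sq).atBot_div_const two_pos
  have h_parts := integral_Iic_of_hasDerivAt_of_tendsto' h_deriv h_mul.integrableOn h_lim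
  have h_split : (fun u : ℝ => (y - u) * Real.exp (-u ^ 2 / 2)) =
      fun u => -u * Real.exp (-u ^ 2 / 2) + y * Real.exp (-u ^ 2 / 2) := by
    ext u
    ring
  rw [h_split]
  refine ⟨(h_mul.add (h_exp.const_mul y)).integrableOn, ?_⟩
  rw [integral_add h_mul.integrableOn (h_exp.const_mul y).integrableOn, h_parts,
    integral_const_mul, sub_zero]

open MeasureTheory in
theorem exp_neg_sub_two_sq_le_integral {y : ℝ} (hy : y ≤ 0) :
    Real.exp (-(y - 2) ^ 2 / 2) ≤ ∫ u in Set.Iic y, (y - u) * Real.exp (-u ^ 2 / 2) := by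
  have h_int := (integral_Iic_sub_mul_exp_neg_sq_div_two y).1
  have h_sub : Set.Icc (y - 2) (y - 1) ⊆ Set.Iic y := fun u hu => by
    have := hu.2
    simp only [Set.mem_Iic]
    linarith
  calc Real.exp (-(y - 2) ^ 2 / 2)
      = ∫ _ in Set.Icc (y - 2) (y - 1), Real.exp (-(y - 2) ^ 2 / 2) := by
        rw [setIntegral_const, Real.volume_real_Icc_of_le (by linarith), smul_eq_mul]
        ring
    _ ≤ ∫ u in Set.Icc (y - 2) (y - 1), (y - u) * Real.exp (-u ^ 2 / 2) := by
        refine setIntegral_mono_on (integrableOn_const (by simp)) (h_int.mono_set h_sub)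
          measurableSet_Icc fun u hu => ?_
        have h_le : Real.exp (-(y - 2) ^ 2 / 2) ≤ Real.exp (-u ^ 2 / 2) :=
          Real.exp_le_exp.2 (by nlinarith [hu.1, hu.2])
        nlinarith [hu.2, Real.exp_pos (-u ^ 2 / 2)]
    _ ≤ ∫ u in Set.Iic y, (y - u) * Real.exp (-u ^ 2 / 2) := by
        refine setIntegral_mono_set h_int ?_ (LE.le.eventuallyLE h_sub)
        refine (ae_restrict_mem measurableSet_Iic).mono fun u hu => ?_
        exact mul_nonneg (sub_nonneg.2 hu) (Real.exp_pos _).le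

open MeasureTheory in
theorem bachelierEuropeanCall_le {s₀ K σ T : ℝ} (hK : s₀ ≤ K) :
    bachelierEuropeanCall s₀ K σ T ≤
      σ * √T * ((√(2 * π))⁻¹ * Real.exp (-((s₀ - K) / (σ * √T)) ^ 2 / 2)) := by
  have h_cdf : 0 ≤ stdNormalCDF ((s₀ - K) / (σ * √T)) :=
    mul_nonneg (by positivity) (integral_nonneg fun u => (Real.exp_pos _).le)
  have := mul_nonneg (sub_nonneg.2 hK) h_cdf
  simp only [bachelierEuropeanCall, stdNormalPDF]
  linarith

theorem le_bachelierEuropeanCall {s₀ K σ T : ℝ} (hK : s₀ ≤ K) (hσ : 0 < σ * √T) :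
    σ * √T * ((√(2 * π))⁻¹ * Real.exp (-((s₀ - K) / (σ * √T) - 2) ^ 2 / 2)) ≤
      bachelierEuropeanCall s₀ K σ T := by
  have hy : (s₀ - K) / (σ * √T) ≤ 0 := div_nonpos_of_nonpos_of_nonneg (by linarith) hσ.le
  have h_le := exp_neg_sub_two_sq_le_integral hy
  rw [(integral_Iic_sub_mul_exp_neg_sq_div_two _).2] at h_le
  have h_eq : s₀ - K = σ * √T * ((s₀ - K) / (σ * √T)) :=
    (mul_div_cancel₀ _ hσ.ne').symm
  calc _ ≤ σ * √T * ((√(2 * π))⁻¹ * (Real.exp (-((s₀ - K) / (σ * √T)) ^ 2 / 2) +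
        (s₀ - K) / (σ * √T) * ∫ u in Set.Iic ((s₀ - K) / (σ * √T)), Real.exp (-u ^ 2 / 2))) := by
        gcongr
    _ = σ * √T * stdNormalPDF ((s₀ - K) / (σ * √T)) +
        σ * √T * ((s₀ - K) / (σ * √T)) * stdNormalCDF ((s₀ - K) / (σ * √T)) := by
        simp only [stdNormalPDF, stdNormalCDF]
        ring
    _ = _ := by rw [← h_eq, bachelierEuropeanCall]

theorem sq_mul_log_mul_exp {v c e : ℝ} (hv : 0 < v) (hc : 0 < c) :
    v ^ 2 * Real.log (v * (c * Real.exp (-e ^ 2 / 2))) =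
      v * (v * Real.log v) + v ^ 2 * Real.log c - (v * e) ^ 2 / 2 := by
  rw [Real.log_mul hv.ne' (by positivity), Real.log_mul hc.ne' (Real.exp_pos _).ne', Real.log_exp]
  ring

/-- **Small-time asymptotics of the implied normal volatility** of an out-of-the-money call:
if `C(T) = C_E(σ_N(T), T)` and `C(T) → 0` as `T → 0⁺`, then
`σ_N(T)² T (log s₀ - log C(T)) → (s₀-K)²/2`. -/
theorem implied_normal_vol_asymptotics
    (s₀ K T₀ : ℝ) (hs₀ : 0 < s₀) (hK : s₀ < K) (hT₀ : 0 < T₀)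
    (C σN : ℝ → ℝ)
    (hC_pos : ∀ T ∈ Set.Ioo (0 : ℝ) T₀, 0 < C T)
    (hσN_pos : ∀ T ∈ Set.Ioo (0 : ℝ) T₀, 0 < σN T)
    (hmatch : ∀ T ∈ Set.Ioo (0 : ℝ) T₀, C T = bachelierEuropeanCall s₀ K (σN T) T)
    (hC0 : Tendsto C (nhdsWithin 0 (Set.Ioi 0)) (nhds 0)) :
    Tendsto (fun T => σN T ^ 2 * T * (Real.log s₀ - Real.log (C T)))
      (nhdsWithin 0 (Set.Ioi 0)) (nhds ((s₀ - K) ^ 2 / 2)) := by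
  set v : ℝ → ℝ := fun T => σN T * √T with hv_def
  set c : ℝ := (√(2 * π))⁻¹ with hc_def
  have hc : 0 < c := by positivity
  have h_mem : ∀ᶠ T in nhdsWithin (0 : ℝ) (Set.Ioi 0), T ∈ Set.Ioo 0 T₀ :=
    Ioo_mem_nhdsGT hT₀
  have hv_pos : ∀ T ∈ Set.Ioo 0 T₀, 0 < v T := fun T hT =>
    mul_pos (hσN_pos T hT) (Real.sqrt_pos.2 hT.1)
  have h_lower : ∀ T ∈ Set.Ioo 0 T₀,
      v T * (c * Real.exp (-((s₀ - K) / v T - 2) ^ 2 / 2)) ≤ C T := fun T hT => by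
    rw [hmatch T hT]
    exact le_bachelierEuropeanCall hK.le (hv_pos T hT)
  have h_upper : ∀ T ∈ Set.Ioo 0 T₀,
      C T ≤ v T * (c * Real.exp (-((s₀ - K) / v T) ^ 2 / 2)) := fun T hT => by
    rw [hmatch T hT]
    exact bachelierEuropeanCall_le hK.le
  have hv0 : Tendsto v (nhdsWithin 0 (Set.Ioi 0)) (nhds 0) := by
    refine tendsto_order.2 ⟨fun b hb => h_mem.mono fun T hT => hb.trans (hv_pos T hT),
      fun δ hδ => ?_⟩
    have h_pos : 0 < δ * (c * Real.exp (-((s₀ - K) / δ - 2) ^ 2 / 2)) := by positivity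
    filter_upwards [h_mem, hC0.eventually_lt_const h_pos] with T hT h_lt
    by_contra! h_le
    refine absurd (h_lower T hT) (not_le.2 (h_lt.trans_le ?_))
    have h_div : (K - s₀) / v T ≤ (K - s₀) / δ :=
      div_le_div_of_nonneg_left (by linarith) hδ h_le
    have h_div_pos : 0 ≤ (K - s₀) / v T := div_nonneg (by linarith) (hv_pos T hT).le
    have h_neg : ∀ w : ℝ, (s₀ - K) / w = -((K - s₀) / w) := fun w => by ring
    have h_exp : Real.exp (-((s₀ - K) / δ - 2) ^ 2 / 2) ≤
        Real.exp (-((s₀ - K) / v T - 2) ^ 2 / 2) := by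
      rw [h_neg, h_neg]
      exact Real.exp_le_exp.2 (by nlinarith)
    have := (hv_pos T hT).le
    gcongr
  have h_tendsto : ∀ b : ℝ, Tendsto
      (fun T => v T ^ 2 * Real.log s₀ -
        (v T * (v T * Real.log (v T)) + v T ^ 2 * Real.log c - (s₀ - K - b * v T) ^ 2 / 2))
      (nhdsWithin 0 (Set.Ioi 0)) (nhds ((s₀ - K) ^ 2 / 2)) := fun b => by
    have h_cont : Continuous fun w : ℝ => w ^ 2 * Real.log s₀ -
        (w * (w * Real.log w) + w ^ 2 * Real.log c - (s₀ - K - b * w) ^ 2 / 2) := by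
      have := Real.continuous_mul_log
      fun_prop
    simpa [Function.comp_def] using (h_cont.tendsto 0).comp hv0
  refine tendsto_of_tendsto_of_tendsto_of_le_of_le' (h_tendsto 0) (h_tendsto 2) ?_ ?_
  all_goals
    filter_upwards [h_mem] with T hT
    have hv := hv_pos T hT
    have h_sq : σN T ^ 2 * T = v T ^ 2 := by
      rw [hv_def, mul_pow, Real.sq_sqrt hT.1.le]
    rw [h_sq, mul_sub]
    refine sub_le_sub_left ?_ _
  · have h_log := mul_le_mul_of_nonneg_left
      (Real.log_le_log (hC_pos T hT) (h_upper T hT)) (sq_nonneg (v T))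
    rw [sq_mul_log_mul_exp hv hc, mul_div_cancel₀ _ hv.ne'] at h_log
    simpa using h_log
  · have h_log := mul_le_mul_of_nonneg_left
      (Real.log_le_log (by positivity) (h_lower T hT)) (sq_nonneg (v T))
    rw [sq_mul_log_mul_exp hv hc, mul_sub, mul_div_cancel₀ _ hv.ne', mul_comm (v T) 2] at h_log
    exact h_log
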